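/- For the StackMST(0,0) game with red tree T on n ≥ 3 vertices with nonnegative edge costs, the optimal revenue satisfies r*(T, c) ≥ c(T) / (7/4 + 7/(2n − 4)). -/

import Mathlib

namespace StackMST

variable {V : Type*}

/-- Sum of an edge-weight function over a set of edges. -/
noncomputable def esum (w : Sym2 V → ℝ) (s : Set (Sym2 V)) : ℝ := ∑ᶠ e ∈ s, w e

/-- `M` is a spanning tree of `G`. -/
def IsSpanningTreeOf (G M : SimpleGraph V) : Prop := M ≤ G ∧ M.IsTree

/-- Total weight of `M`, where red edges (the edges of `T`) are weighted by `c`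
and all other (blue) edges are weighted by `p`. -/
noncomputable def weight (T : SimpleGraph V) (c p : Sym2 V → ℝ) (M : SimpleGraph V) : ℝ :=
  esum c (M.edgeSet ∩ T.edgeSet) + esum p (M.edgeSet \ T.edgeSet)

/-- Total price of the blue edges of `M`. -/
noncomputable def blueRevenue (T : SimpleGraph V) (p : Sym2 V → ℝ) (M : SimpleGraph V) : ℝ :=
  esum p (M.edgeSet \ T.edgeSet)

/-- The leader's revenue once `F` and `p` are fixed: the follower selects a
minimum-weight spanning tree of `T ⊔ F` and, among those, one maximizing the
total price of the blue edges it contains. -/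
noncomputable def followerRevenue (T : SimpleGraph V) (c : Sym2 V → ℝ)
    (F : SimpleGraph V) (p : Sym2 V → ℝ) : ℝ :=
  sSup {r | ∃ M : SimpleGraph V, IsSpanningTreeOf (T ⊔ F) M ∧
    (∀ M' : SimpleGraph V, IsSpanningTreeOf (T ⊔ F) M' →
        weight T c p M ≤ weight T c p M') ∧
    r = blueRevenue T p M}

/-- `F` is a set of blue edges: none of its edges is a red edge. -/
def IsBlueSet (T F : SimpleGraph V) : Prop := F ≤ Tᶜ

/-- `r(F)`: the best revenue the leader can obtain from the activated set `F`. -/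
noncomputable def revenueOf (T : SimpleGraph V) (c : Sym2 V → ℝ) (F : SimpleGraph V) : ℝ :=
  sSup {r | ∃ p : Sym2 V → ℝ, (∀ e ∈ F.edgeSet, 0 ≤ p e) ∧ r = followerRevenue T c F p}

/-- Optimal revenue `r*(T, c)` of the StackMST(0,0) game on the red tree `T`. -/
noncomputable def optRevenue (T : SimpleGraph V) (c : Sym2 V → ℝ) : ℝ :=
  sSup {r | ∃ (F : SimpleGraph V) (p : Sym2 V → ℝ), IsBlueSet T F ∧
    (∀ e ∈ F.edgeSet, 0 ≤ p e) ∧ r = followerRevenue T c F p}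

/-- Total cost `c(T)` of the red edges. -/
noncomputable def redCost (T : SimpleGraph V) (c : Sym2 V → ℝ) : ℝ := esum c T.edgeSet

/-- Optimal revenue of the budgeted game StackMST(γ, Δ). -/
noncomputable def gammaOptRevenue (T : SimpleGraph V) (c γ : Sym2 V → ℝ) (Δ : ℝ) : ℝ :=
  sSup {r | ∃ F : SimpleGraph V, IsBlueSet T F ∧ esum γ F.edgeSet ≤ Δ ∧
    r = revenueOf T c F}

end StackMST

open StackMST

namespace StackMST

open SimpleGraph

/-- If `A` and `B` have the same cardinality and `A` has at least as many light elements as `B`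
at every threshold, then `A` is at most as heavy as `B`. -/
lemma sum_le_of_count {α : Type*} [DecidableEq α] (W : α → ℝ) : ∀ (n : ℕ) (A B : Finset α),
    A.card = n → B.card = n →
    (∀ t, (B.filter (fun e => W e ≤ t)).card ≤ (A.filter (fun e => W e ≤ t)).card) →
    ∑ e ∈ A, W e ≤ ∑ e ∈ B, W e := by
  intro n
  induction n with
  | zero =>
    intro A B hA hB _
    rw [Finset.card_eq_zero] at hA hB
    subst hA hB
    simp
  | succ n ih =>
    intro A B hA hB h
    obtain ⟨a, ha, hamax⟩ := A.exists_max_image W (Finset.card_pos.1 (by omega))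
    obtain ⟨b, hb, hbmax⟩ := B.exists_max_image W (Finset.card_pos.1 (by omega))
    have hab : W a ≤ W b := by
      clear hamax
      have h1 := h (W b)
      rw [Finset.filter_true_of_mem hbmax] at h1
      have h2 : A.filter (fun e => W e ≤ W b) = A :=
        Finset.eq_of_subset_of_card_le (Finset.filter_subset _ _) (by omega)
      rw [← h2] at ha
      exact (Finset.mem_filter.1 ha).2
    have hA' : (A.erase a).card = n := by rw [Finset.card_erase_of_mem ha]; omega
    have hB' : (B.erase b).card = n := by rw [Finset.card_erase_of_mem hb]; omega
    have := ih (A.erase a) (B.erase b) hA' hB' (by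
      intro t
      by_cases ht : W a ≤ t
      · have : (A.erase a).filter (fun e => W e ≤ t) = A.erase a :=
          Finset.filter_true_of_mem fun e he => (hamax e (Finset.mem_of_mem_erase he)).trans ht
        rw [this, hA', ← hB']
        exact Finset.card_le_card (Finset.filter_subset _ _)
      · have : (A.erase a).filter (fun e => W e ≤ t) = A.filter (fun e => W e ≤ t) := by
          ext e
          simp only [Finset.mem_filter, Finset.mem_erase]
          constructor
          · rintro ⟨⟨_, h1⟩, h2⟩; exact ⟨h1, h2⟩
          · rintro ⟨h1, h2⟩; exact ⟨⟨by rintro rfl; exact ht h2, h1⟩, h2⟩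
        rw [this]
        exact (Finset.card_le_card
          (Finset.filter_subset_filter _ (Finset.erase_subset _ _))).trans (h t))
    rw [← Finset.add_sum_erase A W ha, ← Finset.add_sum_erase B W hb]
    linarith

/-- If every edge of a graph joins vertices that are reachable in another graph, then
reachability transfers. -/
lemma reachable_of_adj {V : Type*} {G H : SimpleGraph V}
    (h : ∀ u v, G.Adj u v → H.Reachable u v) {u v : V} (huv : G.Reachable u v) :
    H.Reachable u v := by
  obtain ⟨p⟩ := huv
  induction p with
  | nil => exact Reachable.refl _
  | cons hadj _ ih => exact (h _ _ hadj).trans ih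

open Classical in
/-- Cycle property: a tree connecting each edge of `M'` by lighter edges is at most as heavy. -/
lemma mst_of_reach {V : Type*} [Fintype V] (M M' : SimpleGraph V) (W : Sym2 V → ℝ)
    (hM : M.IsTree) (hM' : M'.IsTree)
    (h : ∀ u v, M'.Adj u v →
      (fromEdgeSet {f | f ∈ M.edgeSet ∧ W f ≤ W s(u, v)}).Reachable u v) :
    ∑ f ∈ M.edgeFinset, W f ≤ ∑ f ∈ M'.edgeFinset, W f := by
  have c1 := hM.card_edgeFinset
  have c2 := hM'.card_edgeFinset
  refine sum_le_of_count W M.edgeFinset.card _ _ rfl (by omega) fun t => ?_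
  set S : Finset (Sym2 V) := M.edgeFinset.filter (fun e => W e ≤ t) ∪
    M'.edgeFinset.filter (fun e => ¬ W e ≤ t) with hS
  have hconn : (fromEdgeSet (S : Set (Sym2 V))).Connected := by
    have := hM'.1.nonempty
    refine ⟨fun u v => reachable_of_adj (G := M') ?_ (hM'.1.preconnected u v)⟩
    intro u v huv
    by_cases ht : W s(u, v) ≤ t
    · refine (h u v huv).mono (fromEdgeSet_mono ?_)
      rintro f ⟨hf1, hf2⟩
      simp only [hS, Finset.coe_union, Set.mem_union, Finset.mem_coe, Finset.mem_filter,
        mem_edgeFinset]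
      exact Or.inl ⟨hf1, hf2.trans ht⟩
    · apply Adj.reachable
      rw [fromEdgeSet_adj]
      refine ⟨?_, huv.ne⟩
      simp only [hS, Finset.coe_union, Set.mem_union, Finset.mem_coe, Finset.mem_filter,
        mem_edgeFinset]
      exact Or.inr ⟨huv, ht⟩
  have h1 := hconn.card_vert_le_card_edgeSet_add_one
  have h2 : Nat.card (fromEdgeSet (S : Set (Sym2 V))).edgeSet ≤ S.card := by
    rw [Nat.card_coe_set_eq, ← Set.ncard_coe_finset S]
    refine Set.ncard_le_ncard ?_ (Set.toFinite _)
    rw [edgeSet_fromEdgeSet]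
    exact Set.sdiff_subset
  have h3 := Finset.card_union_le (M.edgeFinset.filter (fun e => W e ≤ t))
    (M'.edgeFinset.filter (fun e => ¬ W e ≤ t))
  have h4 := Finset.card_filter_add_card_filter_not (s := M'.edgeFinset) (fun e => W e ≤ t)
  rw [Nat.card_eq_fintype_card] at h1
  rw [← hS] at h3
  omega

open Classical in
lemma esum_eq {V : Type*} [Fintype V] (w : Sym2 V → ℝ) (s : Set (Sym2 V)) :
    esum w s = ∑ e ∈ s.toFinset, w e := by
  unfold esum
  rw [finsum_mem_eq_toFinset_sum]

open Classical in
lemma weight_eq {V : Type*} [Fintype V] (T : SimpleGraph V) (c p : Sym2 V → ℝ)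
    (M : SimpleGraph V) :
    weight T c p M = ∑ f ∈ M.edgeFinset, if f ∈ T.edgeSet then c f else p f := by
  unfold weight
  rw [esum_eq, esum_eq, Finset.sum_ite]
  congr 1 <;> apply Finset.sum_congr _ (fun _ _ => rfl) <;> ext e <;> simp

open Classical in
lemma blueRevenue_eq {V : Type*} [Fintype V] (T : SimpleGraph V) (p : Sym2 V → ℝ)
    (M : SimpleGraph V) :
    blueRevenue T p M = ∑ f ∈ M.edgeFinset with f ∉ T.edgeSet, p f := by
  unfold blueRevenue
  rw [esum_eq]
  apply Finset.sum_congr _ (fun _ _ => rfl)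
  ext e; simp

/-- Any blue revenue of a minimum spanning tree is at most the red cost. -/
lemma blueRevenue_le {V : Type*} [Finite V] (T : SimpleGraph V) (hT : T.IsTree)
    (c : Sym2 V → ℝ) (hc : ∀ e ∈ T.edgeSet, 0 ≤ c e) (F : SimpleGraph V) (p : Sym2 V → ℝ)
    (M : SimpleGraph V)
    (hmin : ∀ M' : SimpleGraph V, IsSpanningTreeOf (T ⊔ F) M' →
        weight T c p M ≤ weight T c p M') :
    blueRevenue T p M ≤ redCost T c := by
  classical
  have := Fintype.ofFinite V
  have h := hmin T ⟨le_sup_left, hT⟩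
  have h1 : weight T c p T = redCost T c := by
    unfold weight redCost
    rw [Set.inter_self, Set.sdiff_self]
    simp [esum]
  have h2 : 0 ≤ esum c (M.edgeSet ∩ T.edgeSet) := by
    rw [esum_eq]
    refine Finset.sum_nonneg fun e he => hc e ?_
    simp only [Set.mem_toFinset] at he
    exact he.2
  have h3 : weight T c p M = esum c (M.edgeSet ∩ T.edgeSet) + blueRevenue T p M := rfl
  linarith

lemma le_optRevenue {V : Type*} [Finite V] (T : SimpleGraph V) (hT : T.IsTree)
    (c : Sym2 V → ℝ) (hc : ∀ e ∈ T.edgeSet, 0 ≤ c e) (F : SimpleGraph V) (p : Sym2 V → ℝ)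
    (hF : IsBlueSet T F) (hp : ∀ e ∈ F.edgeSet, 0 ≤ p e)
    (M : SimpleGraph V) (hM : IsSpanningTreeOf (T ⊔ F) M)
    (hmin : ∀ M' : SimpleGraph V, IsSpanningTreeOf (T ⊔ F) M' →
        weight T c p M ≤ weight T c p M') :
    blueRevenue T p M ≤ optRevenue T c := by
  classical
  have := Fintype.ofFinite V
  have hred : 0 ≤ redCost T c := by
    unfold redCost
    rw [esum_eq]
    refine Finset.sum_nonneg fun e he => hc e ?_
    simpa using he
  have h1 : blueRevenue T p M ≤ followerRevenue T c F p := by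
    refine le_csSup ⟨redCost T c, ?_⟩ ⟨M, hM, hmin, rfl⟩
    rintro _ ⟨N, _, hN, rfl⟩
    exact blueRevenue_le T hT c hc F p N hN
  refine h1.trans (le_csSup ⟨redCost T c, ?_⟩ ⟨F, p, hF, hp, rfl⟩)
  rintro _ ⟨F', p', _, _, rfl⟩
  refine Real.sSup_le ?_ hred
  rintro _ ⟨N, _, hN, rfl⟩
  exact blueRevenue_le T hT c hc F' p' N hN

open Classical in
/-- Certificate for a lower bound on the optimal revenue. -/
lemma revenue_ge {V : Type*} [Fintype V] (T : SimpleGraph V) (hT : T.IsTree)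
    (c : Sym2 V → ℝ) (hc : ∀ e ∈ T.edgeSet, 0 ≤ c e) (φ : Sym2 V → Sym2 V) (w : Sym2 V → ℝ)
    (hw : ∀ e ∈ T.edgeSet, 0 ≤ w e)
    (hred : ∀ e ∈ T.edgeSet, φ e ∈ T.edgeSet → w e = c (φ e))
    (hconn : ∀ u v, T.Adj u v →
      (fromEdgeSet (φ '' {e | e ∈ T.edgeSet ∧ w e ≤ c s(u, v)})).Reachable u v) :
    ∑ e ∈ T.edgeFinset with φ e ∉ T.edgeSet, w e ≤ optRevenue T c := by
  set M := fromEdgeSet (φ '' T.edgeSet) with hMdef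
  have hMc : M.Connected := by
    have := hT.1.nonempty
    refine ⟨fun u v => reachable_of_adj (G := T) ?_ (hT.1.preconnected u v)⟩
    intro u v huv
    exact (hconn u v huv).mono (fromEdgeSet_mono (Set.image_mono fun e he => he.1))
  have hTcard := (isTree_iff_connected_and_card.1 hT).2
  have k1 := hMc.card_vert_le_card_edgeSet_add_one
  have hsub : M.edgeSet ⊆ φ '' T.edgeSet := by
    rw [hMdef, edgeSet_fromEdgeSet]; exact Set.sdiff_subset
  have k2 : M.edgeSet.ncard ≤ (φ '' T.edgeSet).ncard := Set.ncard_le_ncard hsub (Set.toFinite _)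
  have k3 : (φ '' T.edgeSet).ncard ≤ T.edgeSet.ncard := Set.ncard_image_le (Set.toFinite _)
  rw [Nat.card_coe_set_eq] at hTcard k1
  have hinj : Set.InjOn φ T.edgeSet := Set.injOn_of_ncard_image_eq (by omega) (Set.toFinite _)
  have hMe : M.edgeSet = φ '' T.edgeSet := Set.eq_of_subset_of_ncard_le hsub (by omega)
    (Set.toFinite _)
  have hM : M.IsTree := isTree_iff_connected_and_card.2 ⟨hMc, by rw [Nat.card_coe_set_eq]; omega⟩
  obtain ⟨e0, -⟩ : ∃ e0 : Sym2 V, True := ⟨s(hT.1.nonempty.some, hT.1.nonempty.some), trivial⟩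
  have : Nonempty (Sym2 V) := ⟨e0⟩
  set ψ := Function.invFunOn φ T.edgeSet with hψ
  have hψφ : ∀ e ∈ T.edgeSet, ψ (φ e) = e := fun e he => hinj.leftInvOn_invFunOn he
  set p : Sym2 V → ℝ := fun f => w (ψ f) with hp
  set W : Sym2 V → ℝ := fun f => if f ∈ T.edgeSet then c f else p f with hW
  have hWφ : ∀ e ∈ T.edgeSet, W (φ e) = w e := by
    intro e he
    simp only [hW, hp]
    split_ifs with h
    · exact (hred e he h).symm
    · rw [hψφ e he]
  have hsup : T ⊔ (M \ T) = T ⊔ M := sup_sdiff_self_right _ _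
  have key : blueRevenue T p M ≤ optRevenue T c := by
    refine le_optRevenue T hT c hc (M \ T) p ?_ ?_ M ?_ ?_
    · intro u v h
      rw [sdiff_adj] at h
      rw [compl_adj]
      exact ⟨h.1.ne, h.2⟩
    · intro f hf
      have hf' : f ∈ M.edgeSet := edgeSet_mono sdiff_le hf
      rw [hMe] at hf'
      obtain ⟨e, he, rfl⟩ := hf'
      simp only [hp]
      rw [hψφ e he]
      exact hw e he
    · rw [hsup]; exact ⟨le_sup_right, hM⟩
    · rintro M' ⟨hle, hM'⟩
      rw [hsup] at hle
      rw [weight_eq, weight_eq]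
      refine mst_of_reach M M' W hM hM' ?_
      intro u v huv
      rcases hle huv with h | h
      · refine (hconn u v h).mono (fromEdgeSet_mono ?_)
        rintro _ ⟨e, ⟨he, hle⟩, rfl⟩
        refine ⟨by rw [hMe]; exact ⟨e, he, rfl⟩, ?_⟩
        rw [hWφ e he]
        have : W s(u, v) = c s(u, v) := if_pos h
        rw [this]; exact hle
      · apply Adj.reachable
        rw [fromEdgeSet_adj]
        exact ⟨⟨h, le_rfl⟩, h.ne⟩
  refine le_trans (le_of_eq ?_) key
  rw [blueRevenue_eq]
  symm
  refine (Finset.sum_congr (s₂ := (T.edgeFinset.filter (fun e => φ e ∉ T.edgeSet)).image φ) ?_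
    fun _ _ => rfl).trans ?_
  · ext f
    simp only [Finset.mem_filter, mem_edgeFinset, Finset.mem_image, hMe, Set.mem_image]
    constructor
    · rintro ⟨⟨e, he, rfl⟩, h⟩; exact ⟨e, ⟨he, h⟩, rfl⟩
    · rintro ⟨e, ⟨he, h⟩, rfl⟩; exact ⟨⟨e, he, rfl⟩, h⟩
  rw [Finset.sum_image]
  · refine Finset.sum_congr rfl fun e he => ?_
    simp only [Finset.mem_filter, mem_edgeFinset] at he
    simp only [hp]
    rw [hψφ e he.1]
  · intro e he e' he' h
    simp only [Finset.coe_filter, mem_edgeFinset, Set.mem_ofPred_eq] at he he'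
    exact hinj he.1 he'.1 h

/-- In an acyclic graph an edge is not bypassed by a walk of other edges. -/
lemma not_adj_of_bypass {V : Type*} {T : SimpleGraph V} (hT : T.IsAcyclic) {a b x z : V}
    (hab : T.Adj a b) (hne : s(x, z) ≠ s(a, b))
    (h1 : (T \ fromEdgeSet {s(a, b)}).Reachable a x)
    (h2 : (T \ fromEdgeSet {s(a, b)}).Reachable b z) : ¬ T.Adj x z := by
  intro h
  have hbr := (isAcyclic_iff_forall_adj_isBridge.1 hT) hab
  rw [isBridge_iff] at hbr
  apply hbr
  refine h1.trans (Reachable.trans (Adj.reachable ?_) h2.symm)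
  rw [sdiff_adj, fromEdgeSet_adj]
  exact ⟨h, fun h' => hne h'.1⟩

open Classical in
/-- Main construction: the revenue is at least two thirds of the red cost minus the cheapest
edge. -/
lemma main_bound {V : Type*} [Fintype V] (T : SimpleGraph V) (hT : T.IsTree)
    (hn : 3 ≤ Nat.card V)
    (c : Sym2 V → ℝ) (hc : ∀ e ∈ T.edgeSet, 0 ≤ c e)
    {κ : Type*} [LinearOrder κ] (key : Sym2 V → κ) (hinj : Function.Injective key)
    (hkey : ∀ e f, key e ≤ key f → c e ≤ c f) :
    ∃ e0 ∈ T.edgeSet, (∀ e ∈ T.edgeSet, c e0 ≤ c e) ∧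
      2 / 3 * (∑ e ∈ T.edgeFinset, c e - c e0) ≤ optRevenue T c := by
  have hnt : Nontrivial V := by
    rw [← Finite.one_lt_card_iff_nontrivial]; omega
  -- cheapest edge at each vertex
  have hnb : ∀ v, ∃ u, T.Adj v u ∧ ∀ u', T.Adj v u' → key s(v, u) ≤ key s(v, u') := by
    intro v
    obtain ⟨u0, hu0⟩ := hT.1.preconnected.exists_adj_of_nontrivial v
    obtain ⟨u, hu, hmin⟩ := (T.neighborFinset v).exists_min_image (fun u => key s(v, u))
      ⟨u0, by simpa using hu0⟩
    exact ⟨u, by simpa using hu, fun u' hu' => hmin u' (by simpa using hu')⟩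
  choose nb hnbadj hnbmin using hnb
  -- doubly cheapest edges
  set L : Set (Sym2 V) := {e | e ∈ T.edgeSet ∧ ∀ v ∈ e, s(v, nb v) = e} with hL
  have hLnb : ∀ i ∈ L, ∀ v ∈ i, nb v ∈ i := by
    intro i hi v hv
    rw [← hi.2 v hv]; simp
  have hLit : ∀ i ∈ L, ∀ n, ∀ v ∈ i, nb^[n] v ∈ i := by
    intro i hi n
    induction n with
    | zero => intro v hv; exact hv
    | succ n ih => intro v hv; exact ih _ (hLnb i hi v hv)
  -- components of the forest of cheapest edges
  set P : Sym2 V → V → Prop := fun i v => ∃ n, nb^[n] v ∈ i with hP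
  have hPmem : ∀ i v, v ∈ i → P i v := fun i v h => ⟨0, h⟩
  have hPnb : ∀ i ∈ L, ∀ v, P i (nb v) ↔ P i v := by
    intro i hi v
    constructor
    · rintro ⟨n, hn⟩; exact ⟨n + 1, hn⟩
    · rintro ⟨n, hn⟩
      cases n with
      | zero => exact ⟨0, hLnb i hi v hn⟩
      | succ n => exact ⟨n, hn⟩
  have hPuniq : ∀ i ∈ L, ∀ j ∈ L, ∀ v, P i v → P j v → i = j := by
    rintro i hi j hj v ⟨n, hn⟩ ⟨m, hm⟩
    have h1 := hLit i hi m _ hn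
    have h2 := hLit j hj n _ hm
    rw [← Function.iterate_add_apply] at h1 h2
    rw [add_comm n m] at h2
    rw [← hi.2 _ h1, ← hj.2 _ h2]
  have hkeynb : ∀ v, key s(nb v, nb (nb v)) ≤ key s(v, nb v) := by
    intro v
    rw [Sym2.eq_swap (a := v)]
    exact hnbmin _ _ (hnbadj v).symm
  have hkeyit : ∀ n v, key s(nb^[n] v, nb (nb^[n] v)) ≤ key s(v, nb v) := by
    intro n
    induction n with
    | zero => intro v; exact le_rfl
    | succ n ih => intro v; exact (ih (nb v)).trans (hkeynb v)
  -- the cheapest edge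
  obtain ⟨e0, he0, hmin0⟩ := T.edgeFinset.exists_min_image key (by
    obtain ⟨v⟩ := hT.1.nonempty
    exact ⟨s(v, nb v), by simpa using hnbadj v⟩)
  rw [mem_edgeFinset] at he0
  have he0L : e0 ∈ L := by
    refine ⟨he0, fun v hv => ?_⟩
    obtain ⟨u, rfl⟩ := hv
    apply hinj
    refine le_antisymm (hnbmin v u he0) (hmin0 _ (by simpa using hnbadj v))
  refine ⟨e0, he0, fun e he => hkey _ _ (hmin0 e (by simpa using he)), ?_⟩
  obtain ⟨r, hr⟩ : ∃ r, r ∈ e0 := by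
    induction e0 with | _ a b => exact ⟨a, by simp⟩
  -- exit edges
  have hleave : ∀ i, ∃ a b, i ∈ L → i ≠ e0 →
      T.Adj a b ∧ P i a ∧ ¬ P i b ∧ T.dist b r < T.dist a r := by
    intro i
    by_cases hi : i ∈ L
    swap
    · exact ⟨r, r, fun h => absurd h hi⟩
    by_cases hi0 : i = e0
    · exact ⟨r, r, fun _ h => absurd hi0 h⟩
    obtain ⟨v0, hv0⟩ : ∃ v, v ∈ i := by
      induction i with | _ a b => exact ⟨a, by simp⟩
    obtain ⟨a, ha, hamin⟩ := (Finset.univ.filter (P i)).exists_min_image (fun v => T.dist v r)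
      ⟨v0, by simpa using hPmem i v0 hv0⟩
    simp only [Finset.mem_filter, Finset.mem_univ, true_and] at ha hamin
    have har : a ≠ r := by
      rintro rfl
      exact hi0 (hPuniq i hi e0 he0L a ha (hPmem _ _ hr))
    obtain ⟨p, hp⟩ := hT.1.exists_walk_length_eq_dist a r
    cases p with
    | nil => exact absurd rfl har
    | @cons _ b _ hadj q =>
      have hlt : T.dist b r < T.dist a r := by
        rw [← hp, Walk.length_cons]
        exact Nat.lt_succ_of_le (dist_le q)
      refine ⟨a, b, fun _ _ => ⟨hadj, ha, fun hb => ?_, hlt⟩⟩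
      exact absurd (hamin b hb) (not_le.2 hlt)
  choose a b hleave using hleave
  have hxy : ∀ i : Sym2 V, ∃ x y, i = s(x, y) := by
    intro i
    induction i with | _ a b => exact ⟨a, b, rfl⟩
  choose x y hxy using hxy
  have hxmem : ∀ i, x i ∈ i := fun i => by
    have h : x i ∈ s(x i, y i) := Sym2.mem_mk_left _ _
    rwa [← hxy i] at h
  have hymem : ∀ i, y i ∈ i := fun i => by
    have h : y i ∈ s(x i, y i) := Sym2.mem_mk_right _ _
    rwa [← hxy i] at h
  have huv : ∀ e, ∃ u v, e ∈ T.edgeSet → e ∉ L → e = s(u, v) ∧ s(v, nb v) ≠ e := by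
    intro e
    by_cases he : e ∈ T.edgeSet
    swap
    · exact ⟨r, r, fun h => absurd h he⟩
    by_cases heL : e ∈ L
    · exact ⟨r, r, fun _ h => absurd heL h⟩
    have : ∃ v ∈ e, s(v, nb v) ≠ e := by
      by_contra hcon
      push Not at hcon
      exact heL ⟨he, hcon⟩
    obtain ⟨v, ⟨u, rfl⟩, hv⟩ := this
    exact ⟨u, v, fun _ _ => ⟨Sym2.eq_swap, hv⟩⟩
  choose u v huv using huv
  set g : Sym2 V → Sym2 V := fun i => s(a i, b i) with hg
  -- facts on exit edges
  have hgT : ∀ i ∈ L, i ≠ e0 → g i ∈ T.edgeSet := fun i hi h0 => (hleave i hi h0).1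
  have hga : ∀ i ∈ L, i ≠ e0 → ∀ v, P i v → s(v, nb v) ≠ g i := by
    intro i hi h0 v hv heq
    have hb := (hleave i hi h0).2.2.1
    have : b i ∈ s(v, nb v) := by rw [heq]; simp [hg]
    rw [Sym2.mem_iff] at this
    rcases this with h | h
    · exact hb (h ▸ hv)
    · exact hb (h ▸ (hPnb i hi v).2 hv)
  have hgb : ∀ i ∈ L, i ≠ e0 → s(b i, nb (b i)) ≠ g i := by
    intro i hi h0 heq
    obtain ⟨_, ha, hb, _⟩ := hleave i hi h0
    have : a i ∈ s(b i, nb (b i)) := by rw [heq]; simp [hg]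
    rw [Sym2.mem_iff] at this
    rcases this with h | h
    · exact hb (h ▸ ha)
    · exact hb ((hPnb i hi _).1 (h ▸ ha))
  have hgL : ∀ i ∈ L, i ≠ e0 → g i ∉ L := by
    intro i hi h0 h
    exact hgb i hi h0 (h.2 _ (by simp [hg]))
  have hginj : ∀ i ∈ L, i ≠ e0 → ∀ j ∈ L, j ≠ e0 → g i = g j → i = j := by
    intro i hi h0 j hj h0' heq
    obtain ⟨_, ha, _, hd⟩ := hleave i hi h0
    obtain ⟨_, ha', _, hd'⟩ := hleave j hj h0'
    simp only [hg, Sym2.eq_iff] at heq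
    rcases heq with ⟨h, _⟩ | ⟨h, h'⟩
    · exact hPuniq i hi j hj _ ha (h ▸ ha')
    · rw [h, h'] at hd; omega
  have hgkey : ∀ i ∈ L, i ≠ e0 → key s(a i, nb (a i)) < key (g i) := by
    intro i hi h0
    obtain ⟨hadj, ha, _, _⟩ := hleave i hi h0
    exact lt_of_le_of_ne (hnbmin _ _ hadj) fun h => hga i hi h0 _ ha (hinj h)
  have hgkeyb : ∀ i ∈ L, i ≠ e0 → key s(b i, nb (b i)) < key (g i) := by
    intro i hi h0
    obtain ⟨hadj, ha, _, _⟩ := hleave i hi h0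
    refine lt_of_le_of_ne ?_ fun h => hgb i hi h0 (hinj h)
    simp only [hg]
    rw [Sym2.eq_swap (a := a i)]
    exact hnbmin _ _ hadj.symm
  have hcg : ∀ i ∈ L, i ≠ e0 → c i ≤ c (g i) := by
    intro i hi h0
    obtain ⟨hadj, ⟨n, hn⟩, _, _⟩ := hleave i hi h0
    apply hkey
    have := hkeyit n (a i)
    rw [hi.2 _ hn] at this
    exact this.trans (hgkey i hi h0).le
  set A : Finset (Sym2 V) := T.edgeFinset.filter
    (fun i => i ∈ L ∧ i ≠ e0 ∧ c (g i) < 2 * c i) with hA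
  have hAmem : ∀ i ∈ A, i ∈ L ∧ i ≠ e0 := by
    intro i hi
    rw [hA, Finset.mem_filter] at hi
    exact ⟨hi.2.1, hi.2.2.1⟩
  have hgi : ∀ e, ∃ i, (∃ j ∈ A, g j = e) → i ∈ A ∧ g i = e := by
    intro e
    by_cases h : ∃ j ∈ A, g j = e
    · obtain ⟨j, hj⟩ := h; exact ⟨j, fun _ => hj⟩
    · exact ⟨e, fun h' => absurd h' h⟩
  choose gi hgi using hgi
  have hgig : ∀ i ∈ A, gi (g i) = i := by
    intro i hi
    obtain ⟨h1, h2⟩ := hgi (g i) ⟨i, hi, rfl⟩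
    exact hginj _ (hAmem _ h1).1 (hAmem _ h1).2 _ (hAmem _ hi).1 (hAmem _ hi).2 h2
  set φ : Sym2 V → Sym2 V := fun e => if e ∈ A then s(x e, nb (b e))
    else if ∃ j ∈ A, g j = e then s(y (gi e), nb (b (gi e)))
    else if e ∈ L then e else s(u e, nb (v e)) with hφ
  set w : Sym2 V → ℝ := fun e => if ∃ j ∈ A, g j = e then c (gi e) else c e with hw
  have hLgA : ∀ i ∈ L, ¬ ∃ j ∈ A, g j = i := by
    rintro i hi ⟨j, hj, rfl⟩
    exact hgL j (hAmem j hj).1 (hAmem j hj).2 hi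
  have hgA : ∀ j ∈ A, g j ∉ A := fun j hj h =>
    hgL j (hAmem j hj).1 (hAmem j hj).2 (hAmem _ h).1
  have φA : ∀ i ∈ A, φ i = s(x i, nb (b i)) := fun i hi => by simp only [hφ]; rw [if_pos hi]
  have wL : ∀ i ∈ L, w i = c i := fun i hi => by simp only [hw]; rw [if_neg (hLgA i hi)]
  have φgA : ∀ i ∈ A, φ (g i) = s(y i, nb (b i)) := fun i hi => by
    simp only [hφ]; rw [if_neg (hgA i hi), if_pos ⟨i, hi, rfl⟩, hgig i hi]
  have wgA : ∀ i ∈ A, w (g i) = c i := fun i hi => by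
    simp only [hw]; rw [if_pos ⟨i, hi, rfl⟩, hgig i hi]
  have φL : ∀ i ∈ L, i ∉ A → φ i = i := fun i hi hiA => by
    simp only [hφ]; rw [if_neg hiA, if_neg (hLgA i hi), if_pos hi]
  have φN : ∀ e, e ∉ L → (¬ ∃ j ∈ A, g j = e) → φ e = s(u e, nb (v e)) := fun e he h => by
    simp only [hφ]; rw [if_neg fun h => he (hAmem e h).1, if_neg h, if_neg he]
  have wN : ∀ e, (¬ ∃ j ∈ A, g j = e) → w e = c e := fun e h => by
    simp only [hw]; rw [if_neg h]
  -- blue edges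
  have hblueA : ∀ i ∈ A, ∀ z ∈ i, ¬ T.Adj z (nb (b i)) := by
    intro i hiA z hz
    obtain ⟨hi, h0⟩ := hAmem i hiA
    obtain ⟨hadj, ha, hb, _⟩ := hleave i hi h0
    have hstep : ∀ t, s(t, nb t) ≠ g i →
        (T \ fromEdgeSet {s(a i, b i)}).Reachable t (nb t) := by
      intro t ht
      apply Adj.reachable
      rw [sdiff_adj, fromEdgeSet_adj]
      exact ⟨hnbadj t, fun h => ht h.1⟩
    have hchain : ∀ n t, P i t → (T \ fromEdgeSet {s(a i, b i)}).Reachable t (nb^[n] t) := by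
      intro n
      induction n with
      | zero => intro t _; exact Reachable.refl _
      | succ n ih =>
        intro t ht
        exact (hstep t (hga i hi h0 t ht)).trans (ih _ ((hPnb i hi t).2 ht))
    refine not_adj_of_bypass hT.2 hadj ?_ ?_ (hstep _ (hgb i hi h0))
    · intro h
      have : b i ∈ s(z, nb (b i)) := by rw [h]; simp
      rw [Sym2.mem_iff] at this
      rcases this with h | h
      · exact hb (h ▸ hPmem i z hz)
      · exact (hnbadj (b i)).ne h
    · obtain ⟨n, hn⟩ := ha
      refine (hchain n _ ⟨n, hn⟩).trans ?_
      have h1 := hi.2 _ hn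
      have h2 : z ∈ s(nb^[n] (a i), nb (nb^[n] (a i))) := by rw [h1]; exact hz
      rw [Sym2.mem_iff] at h2
      rcases h2 with h | h
      · rw [← h]
      · rw [h]
        exact hstep _ (hga i hi h0 _ (hPmem i _ hn))
  have hblueN : ∀ e ∈ T.edgeSet, e ∉ L → ¬ T.Adj (u e) (nb (v e)) := by
    intro e he heL
    obtain ⟨h1, h2⟩ := huv e he heL
    have hadj : T.Adj (u e) (v e) := by rw [h1] at he; exact he
    refine not_adj_of_bypass hT.2 hadj ?_ (Reachable.refl _) ?_
    · intro h
      have : v e ∈ s(u e, nb (v e)) := by rw [h]; simp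
      rw [Sym2.mem_iff] at this
      rcases this with h | h
      · exact hadj.ne h.symm
      · exact (hnbadj _).ne h
    · apply Adj.reachable
      rw [sdiff_adj, fromEdgeSet_adj]
      exact ⟨hnbadj _, fun h => h2 (h.1.trans h1.symm)⟩
  have hblue : ∀ e ∈ T.edgeSet, (e ∈ A ∨ e ∉ L) → φ e ∉ T.edgeSet := by
    intro e he h
    by_cases heA : e ∈ A
    · rw [φA e heA, mem_edgeSet]
      exact hblueA e heA _ (hxmem e)
    · have heL := h.resolve_left heA
      by_cases hj : ∃ j ∈ A, g j = e
      · obtain ⟨j, hj, rfl⟩ := hj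
        rw [φgA j hj, mem_edgeSet]
        exact hblueA j hj _ (hymem j)
      · rw [φN e heL hj, mem_edgeSet]
        exact hblueN e he heL
  have hw0 : ∀ e ∈ T.edgeSet, 0 ≤ w e := by
    intro e he
    by_cases hj : ∃ j ∈ A, g j = e
    · obtain ⟨j, hj, rfl⟩ := hj
      rw [wgA j hj]
      exact hc j (hAmem j hj).1.1
    · rw [wN e hj]; exact hc e he
  -- connectivity
  set G : Sym2 V → SimpleGraph V := fun e =>
    fromEdgeSet (φ '' {e' | e' ∈ T.edgeSet ∧ w e' ≤ c e}) with hG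
  have hGmono : ∀ e f, c e ≤ c f → G e ≤ G f := by
    intro e f h
    exact fromEdgeSet_mono (Set.image_mono fun e' he' => ⟨he'.1, he'.2.trans h⟩)
  have hGedge : ∀ e f, f ∈ T.edgeSet → w f ≤ c e → ∀ p q, φ f = s(p, q) →
      (G e).Reachable p q := by
    intro e f hf hfe p q hpq
    by_cases hne : p = q
    · rw [hne]
    apply Adj.reachable
    rw [hG, fromEdgeSet_adj]
    exact ⟨⟨f, ⟨hf, hfe⟩, hpq⟩, hne⟩
  have hconn : ∀ e, e ∈ T.edgeSet → ∀ p q, e = s(p, q) → (G e).Reachable p q := by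
    have hwf : WellFounded (fun e f : Sym2 V => key e < key f) := by
      have : IsTrans (Sym2 V) (fun e f => key e < key f) := ⟨fun _ _ _ h1 h2 => lt_trans h1 h2⟩
      have : Std.Irrefl (fun e f : Sym2 V => key e < key f) := ⟨fun _ h => lt_irrefl _ h⟩
      exact Finite.wellFounded_of_trans_of_irrefl _
    intro e
    induction e using hwf.induction with
    | _ e ih =>
    intro he p q hpq
    have hstep : ∀ t, key s(t, nb t) < key e → (G e).Reachable t (nb t) := by
      intro t ht
      exact (ih _ ht (hnbadj t) t (nb t) rfl).mono (hGmono _ _ (hkey _ _ ht.le))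
    have hsym : ∀ p' q', e = s(p', q') → (G e).Reachable p' q' → (G e).Reachable p q := by
      intro p' q' h1 h2
      rw [h1, Sym2.eq_iff] at hpq
      rcases hpq with ⟨rfl, rfl⟩ | ⟨rfl, rfl⟩
      · exact h2
      · exact h2.symm
    by_cases heL : e ∈ L
    · by_cases heA : e ∈ A
      · obtain ⟨hi, h0⟩ := hAmem e heA
        refine hsym (x e) (y e) (hxy e) ?_
        have h1 := hGedge e e he (wL e heL).le _ _ (φA e heA)
        have h2 := hGedge e (g e) (hgT e hi h0) (wgA e heA).le _ _ (φgA e heA)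
        exact h1.trans h2.symm
      · exact hGedge e e he (wL e heL).le _ _ ((φL e heL heA).trans hpq)
    · by_cases hj : ∃ j ∈ A, g j = e
      · obtain ⟨i, hiA, rfl⟩ := hj
        obtain ⟨hi, h0⟩ := hAmem i hiA
        obtain ⟨hadj, ha, hb, _⟩ := hleave i hi h0
        refine hsym (a i) (b i) rfl ?_
        have hchain : ∀ n, (G (g i)).Reachable (a i) (nb^[n] (a i)) := by
          intro n
          induction n with
          | zero => exact Reachable.refl _
          | succ n ih' =>
            rw [Function.iterate_succ_apply']
            exact ih'.trans (hstep _ ((hkeyit n _).trans_lt (hgkey i hi h0)))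
        have hz : ∀ z ∈ i, (G (g i)).Reachable z (nb (b i)) := by
          intro z hz
          rw [hxy i, Sym2.mem_iff] at hz
          rcases hz with rfl | rfl
          · exact hGedge _ i hi.1 ((wL i hi).trans_le (hcg i hi h0)) _ _ (φA i hiA)
          · exact hGedge _ (g i) he ((wgA i hiA).trans_le (hcg i hi h0)) _ _ (φgA i hiA)
        obtain ⟨n, hn⟩ := ha
        exact ((hchain n).trans (hz _ hn)).trans (hstep _ (hgkeyb i hi h0)).symm
      · obtain ⟨h1, h2⟩ := huv e he heL
        refine hsym (u e) (v e) h1 ?_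
        have h3 := hGedge e e he (wN e hj).le _ _ (φN e heL hj)
        refine h3.trans (hstep _ ?_).symm
        refine lt_of_le_of_ne ?_ fun h => h2 (hinj h)
        have hadj : T.Adj (u e) (v e) := by rw [h1] at he; exact he
        have := hnbmin _ _ hadj.symm
        rwa [Sym2.eq_swap (a := v e) (b := u e), ← h1] at this
  have hrev := revenue_ge T hT c hc φ w hw0 (by
    intro e he hφe
    have h : ¬ (e ∈ A ∨ e ∉ L) := fun h => hblue e he h hφe
    push Not at h
    rw [φL e h.2 h.1, wL e h.2]) (fun p q hpq => hconn _ hpq p q rfl)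
  refine le_trans ?_ hrev
  -- lower bound on the sum
  set E := T.edgeFinset with hE
  set N := E.filter (fun e => e ∉ L) with hN
  set K := (E.filter (fun e => e ∈ L)).erase e0 with hK
  have hKmem : ∀ i, i ∈ K ↔ i ∈ L ∧ i ≠ e0 := by
    intro i
    simp only [hK, hE, Finset.mem_erase, Finset.mem_filter, mem_edgeFinset]
    exact ⟨fun h => ⟨h.2.2, h.1⟩, fun h => ⟨h.2, h.1.1, h.1⟩⟩
  have hAK : A = K.filter (fun i => c (g i) < 2 * c i) := by
    ext i
    simp only [hA, Finset.mem_filter, hKmem, hE, mem_edgeFinset]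
    exact ⟨fun h => ⟨⟨h.2.1, h.2.2.1⟩, h.2.2.2⟩, fun h => ⟨h.1.1.1, h.1.1, h.1.2, h.2⟩⟩
  have hginjA : Set.InjOn g (A : Set (Sym2 V)) := fun i hi j hj h =>
    hginj i (hAmem i hi).1 (hAmem i hi).2 j (hAmem j hj).1 (hAmem j hj).2 h
  have hginjK : Set.InjOn g (K : Set (Sym2 V)) := fun i hi j hj h =>
    hginj i ((hKmem i).1 hi).1 ((hKmem i).1 hi).2 j ((hKmem j).1 hj).1 ((hKmem j).1 hj).2 h
  have hKN : K.image g ⊆ N := by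
    intro e he
    rw [Finset.mem_image] at he
    obtain ⟨i, hi, rfl⟩ := he
    obtain ⟨h1, h2⟩ := (hKmem i).1 hi
    rw [hN, Finset.mem_filter, hE, mem_edgeFinset]
    exact ⟨hgT i h1 h2, hgL i h1 h2⟩
  have hAN : A.image g ⊆ N := by
    refine (Finset.image_subset_image ?_).trans hKN
    rw [hAK]; exact Finset.filter_subset _ _
  have hNc : ∀ e ∈ N, 0 ≤ c e := by
    intro e he
    rw [hN, Finset.mem_filter, hE, mem_edgeFinset] at he
    exact hc e he.1
  have s1 : ∑ e ∈ A, w e + ∑ e ∈ N, w e ≤ ∑ e ∈ E with φ e ∉ T.edgeSet, w e := by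
    rw [← Finset.sum_union]
    · apply Finset.sum_le_sum_of_subset_of_nonneg
      · intro e he
        rw [Finset.mem_union] at he
        have heE : e ∈ T.edgeSet := by
          rcases he with h | h
          · exact (hAmem e h).1.1
          · rw [hN, Finset.mem_filter, hE, mem_edgeFinset] at h; exact h.1
        rw [Finset.mem_filter, hE, mem_edgeFinset]
        refine ⟨heE, hblue e heE (he.imp id fun h => ?_)⟩
        exact (Finset.mem_filter.1 h).2
      · intro e he _
        rw [Finset.mem_filter, hE, mem_edgeFinset] at he
        exact hw0 e he.1
    · rw [Finset.disjoint_left]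
      intro e h1 h2
      exact (Finset.mem_filter.1 h2).2 (hAmem e h1).1
  have s2 : ∑ e ∈ A, w e = ∑ e ∈ A, c e := Finset.sum_congr rfl fun e he => wL e (hAmem e he).1
  have s3 : ∑ e ∈ N, w e = ∑ e ∈ N \ A.image g, c e + ∑ i ∈ A, c i := by
    rw [← Finset.sum_sdiff hAN, Finset.sum_image hginjA]
    congr 1
    · refine Finset.sum_congr rfl fun e he => wN e ?_
      rw [Finset.mem_sdiff, Finset.mem_image] at he
      exact he.2
    · exact Finset.sum_congr rfl fun i hi => wgA i hi
  have s4 : ∑ e ∈ N, c e = ∑ e ∈ N \ A.image g, c e + ∑ i ∈ A, c (g i) := by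
    rw [← Finset.sum_sdiff hAN, Finset.sum_image hginjA]
  have s5 : ∑ i ∈ K, c (g i) ≤ ∑ e ∈ N, c e := by
    rw [← Finset.sum_image (f := c) hginjK]
    exact Finset.sum_le_sum_of_subset_of_nonneg hKN fun e he _ => hNc e he
  have s6 : ∑ e ∈ E, c e = c e0 + ∑ i ∈ K, c i + ∑ e ∈ N, c e := by
    rw [hK, Finset.add_sum_erase, hN, Finset.sum_filter_add_sum_filter_not]
    rw [Finset.mem_filter, hE, mem_edgeFinset]
    exact ⟨he0, he0L⟩
  have s7 : ∑ i ∈ K, (2 * c i - c (g i)) ≤ ∑ i ∈ A, (2 * c i - c (g i)) := by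
    rw [hAK, Finset.sum_filter]
    refine Finset.sum_le_sum fun i _ => ?_
    split_ifs with h
    · exact le_rfl
    · linarith
  have s8 : 0 ≤ ∑ i ∈ A, (2 * c i - c (g i)) := by
    refine Finset.sum_nonneg fun i hi => ?_
    rw [hAK, Finset.mem_filter] at hi
    linarith [hi.2]
  rw [Finset.sum_sub_distrib, Finset.sum_sub_distrib, ← Finset.mul_sum, ← Finset.mul_sum] at s7
  rw [Finset.sum_sub_distrib, ← Finset.mul_sum] at s8
  linarith

end StackMST

/-- For the StackMST(0,0) game with red tree `T` on `n ≥ 3`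
vertices with nonnegative edge costs, the optimal revenue satisfies
`r*(T, c) ≥ c(T) / (7/4 + 7/(2n − 4))`. -/
theorem stackMST_seven_fourths_approx {V : Type*} [Finite V]
    (T : SimpleGraph V) (hT : T.IsTree) (hn : 3 ≤ Nat.card V)
    (c : Sym2 V → ℝ) (hc : ∀ e ∈ T.edgeSet, 0 ≤ c e) :
    redCost T c / (7 / 4 + 7 / (2 * (Nat.card V : ℝ) - 4)) ≤ optRevenue T c := by
  classical
  have := Fintype.ofFinite V
  have idx := Fintype.equivFin (Sym2 V)
  obtain ⟨e0, he0, hmin, hbound⟩ := main_bound T hT hn c hc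
    (fun e => toLex (c e, idx e)) (by
      intro e f h
      have h' := toLex.injective h
      exact idx.injective (Prod.ext_iff.1 h').2) (by
      intro e f h
      rw [Prod.Lex.toLex_le_toLex] at h
      rcases h with h | h
      · exact h.le
      · exact h.1.le)
  have hr : redCost T c = ∑ e ∈ T.edgeFinset, c e := by
    unfold redCost
    rw [esum_eq]
    refine Finset.sum_congr ?_ fun _ _ => rfl
    ext e; simp
  have hcard := hT.card_edgeFinset
  rw [← Nat.card_eq_fintype_card] at hcard
  have hle : (T.edgeFinset.card : ℝ) * c e0 ≤ ∑ e ∈ T.edgeFinset, c e := by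
    rw [← nsmul_eq_mul]
    exact Finset.card_nsmul_le_sum _ _ _ fun e he => hmin e (by simpa using he)
  have hcard' : (T.edgeFinset.card : ℝ) = (Nat.card V : ℝ) - 1 := by
    rw [← hcard]; push_cast; ring
  rw [hcard', ← hr] at hle
  rw [← hr] at hbound
  refine le_trans ?_ hbound
  have hn' : (3 : ℝ) ≤ (Nat.card V : ℝ) := by exact_mod_cast hn
  have hS : 0 ≤ redCost T c := by
    rw [hr]
    exact Finset.sum_nonneg fun e he => hc e (by simpa using he)
  generalize (Nat.card V : ℝ) = n at *
  generalize redCost T c = S at *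
  generalize c e0 = d at *
  have h1 : 7 / 4 + 7 / (2 * n - 4) = 7 * n / (4 * (n - 2)) := by
    have : n - 2 ≠ 0 := by linarith
    have : 2 * n - 4 ≠ 0 := by linarith
    have e : 2 * n - 4 = 2 * (n - 2) := by ring
    rw [e]
    field_simp
    ring
  rw [h1, div_div_eq_mul_div, div_le_iff₀ (by positivity)]
  have h2 : 0 ≤ S * (n - 2) := mul_nonneg hS (by linarith)
  have h3 : S * (n - 2) ≤ (S - d) * (n - 1) := by nlinarith
  have h4 : 0 ≤ S - d := by
    by_contra hneg
    push Not at hneg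
    nlinarith
  nlinarith
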